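/- arXiv:2111.00214 — 4 statements merged into one kernel-verified Lean document; each statement's English description precedes it below -/
import Mathlib

section
/- Let R be a local integral domain with maximal ideal 𝔪 and fraction field K, let A be an abelian group, and let φ be a Steinberg symbol on K with values in A. Let a, b ∈ R and s, t ∈ 𝔪, and assume a ≠ 0 and s ≠ 0. Then the identity φ(1 + a·s, 1 + b·t) = − φ(1 + (a·b/(1 + a·s))·s·t, −a·s·(1 + b·t)) holds in A. (All first arguments occurring are units of R, since a·s, b·t and a·b·s·t/(1+a·s) lie in 𝔪; the second argument −a·s·(1+b·t) is a nonzero element of K since R is a domain, a ≠ 0 and s ≠ 0.) This is the identity {1+as, 1+bt} = −{1 + (ab/(1+as))st, −as(1+bt)} in the Milnor K-group K₂^M(K). -/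
/-- The identity `{1 + x, 1 + y} = -{1 + xy/(1 + x), -x(1 + y)}` for a Steinberg symbol on a
field. -/
theorem steinberg_symbol_one_add_one_add {K A : Type*} [Field K] [AddCommGroup A] (φ : K → K → A)
    (hleft : ∀ x y z : K, x ≠ 0 → y ≠ 0 → z ≠ 0 → φ (x * y) z = φ x z + φ y z)
    (hright : ∀ x y z : K, x ≠ 0 → y ≠ 0 → z ≠ 0 → φ x (y * z) = φ x y + φ x z)
    (hst : ∀ x : K, x ≠ 0 → x ≠ 1 → φ x (1 - x) = 0)
    {x y : K} (hx : x ≠ 0) (hx1 : 1 + x ≠ 0) (hy1 : 1 + y ≠ 0) (hxy : 1 + x * (1 + y) ≠ 0) :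
    φ (1 + x) (1 + y) = -φ (1 + x * y / (1 + x)) (-x * (1 + y)) := by
  have hst' (z : K) (hz : z ≠ 0) (hz1 : 1 + z ≠ 0) : φ (1 + z) (-z) = 0 := by
    simpa using hst (1 + z) hz1 (by simpa using hz)
  have hfactor : (1 + x) * (1 + x * y / (1 + x)) = 1 + x * (1 + y) := by
    field_simp
    ring
  have hw : 1 + x * y / (1 + x) ≠ 0 := right_ne_zero_of_mul (hfactor ▸ hxy)
  have hxv : -x * (1 + y) ≠ 0 := mul_ne_zero (neg_ne_zero.mpr hx) hy1
  have h := hst' (x * (1 + y)) (mul_ne_zero hx hy1) hxy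
  rw [← hfactor, ← neg_mul, hleft _ _ _ hx1 hw hxv,
    hright _ _ _ hx1 (neg_ne_zero.mpr hx) hy1, hst' x hx hx1, zero_add] at h
  exact eq_neg_of_add_eq_zero_left h

/-- In the fraction field of a local domain, `1 + m ≠ 0` for `m` in the maximal ideal. -/
theorem one_add_algebraMap_ne_zero_of_mem_maximalIdeal {R K : Type*} [CommRing R]
    [IsLocalRing R] [Field K] [Algebra R K] {m : R} (hm : m ∈ IsLocalRing.maximalIdeal R) :
    1 + algebraMap R K m ≠ 0 := by
  have hu : IsUnit (1 + m) := by
    simpa using IsLocalRing.isUnit_one_sub_self_of_mem_nonunits (-m) (neg_mem hm)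
  simpa using (hu.map (algebraMap R K)).ne_zero

/-- Lemma `lem:lcI`(1): for a Steinberg symbol `φ` on the fraction field `K` of a local
integral domain `R`, with `a b : R`, `s t` in the maximal ideal, `a ≠ 0`, `s ≠ 0`, one has
`φ(1+as, 1+bt) = −φ(1 + (ab/(1+as))st, −as(1+bt))`, i.e. the identity
`{1+as, 1+bt} = −{1 + (ab/(1+as))st, −as(1+bt)}` in `K₂^M(K)`. -/
theorem steinberg_identity_one
    (R : Type*) [CommRing R] [IsDomain R] [IsLocalRing R]
    (K : Type*) [Field K] [Algebra R K] [IsFractionRing R K]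
    (A : Type*) [AddCommGroup A]
    (φ : K → K → A)
    (hleft : ∀ x y z : K, x ≠ 0 → y ≠ 0 → z ≠ 0 → φ (x * y) z = φ x z + φ y z)
    (hright : ∀ x y z : K, x ≠ 0 → y ≠ 0 → z ≠ 0 → φ x (y * z) = φ x y + φ x z)
    (hst : ∀ x : K, x ≠ 0 → x ≠ 1 → φ x (1 - x) = 0)
    (a b s t : R)
    (hs : s ∈ IsLocalRing.maximalIdeal R) (ht : t ∈ IsLocalRing.maximalIdeal R)
    (ha : a ≠ 0) (hs0 : s ≠ 0) :
    φ (1 + algebraMap R K a * algebraMap R K s)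
        (1 + algebraMap R K b * algebraMap R K t)
      = - φ (1 + (algebraMap R K a * algebraMap R K b /
                (1 + algebraMap R K a * algebraMap R K s))
              * algebraMap R K s * algebraMap R K t)
            (-(algebraMap R K a * algebraMap R K s)
              * (1 + algebraMap R K b * algebraMap R K t)) := by
  have has : a * s ∈ IsLocalRing.maximalIdeal R := Ideal.mul_mem_left _ a hs
  have hx : algebraMap R K (a * s) ≠ 0 :=
    (map_ne_zero_iff _ (IsFractionRing.injective R K)).mpr (mul_ne_zero ha hs0)
  have hx1 := one_add_algebraMap_ne_zero_of_mem_maximalIdeal (K := K) has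
  have hy1 := one_add_algebraMap_ne_zero_of_mem_maximalIdeal (K := K)
    (Ideal.mul_mem_left _ b ht)
  have hxy := one_add_algebraMap_ne_zero_of_mem_maximalIdeal (K := K)
    (Ideal.mul_mem_right (1 + b * t) _ has)
  simp only [map_mul, map_add, map_one] at hx hx1 hy1 hxy
  rw [steinberg_symbol_one_add_one_add φ hleft hright hst hx hx1 hy1 hxy]
  congr 3
  ring
end

section
/- Let R be a local integral domain with maximal ideal 𝔪 and fraction field K, let A be an abelian group, and let φ be a Steinberg symbol on K with values in A. Let c ∈ R and s, t ∈ 𝔪 with s ≠ 0. Then the identity φ(1 + ((s − 1)/(1 + c·t))·c·t, 1 − ((1 + c·t)/(1 + c·s·t))·s) = φ(1 + c·s·t, s) holds in A. (Here 1 + c·t and 1 + c·s·t are units of R since c·t, c·s·t ∈ 𝔪; the first argument equals (1 + c·s·t)/(1 + c·t) and the second argument equals (1 − s)/(1 + c·s·t), both of which are units of R since s ∈ 𝔪.) This is the identity {1 + ((s−1)/(1+ct))ct, 1 − ((1+ct)/(1+cst))s} = {1 + cst, s} in the Milnor K-group K₂^M(K). -/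
section Symbol

variable {K A : Type*} [Field K] [AddCommGroup A] {φ : K → K → A}

theorem symbol_one_left
    (hleft : ∀ x y z : K, x ≠ 0 → y ≠ 0 → z ≠ 0 → φ (x * y) z = φ x z + φ y z)
    {z : K} (hz : z ≠ 0) : φ 1 z = 0 := by
  simpa using hleft 1 1 z one_ne_zero one_ne_zero hz

theorem steinberg_self_neg
    (hleft : ∀ x y z : K, x ≠ 0 → y ≠ 0 → z ≠ 0 → φ (x * y) z = φ x z + φ y z)
    (hright : ∀ x y z : K, x ≠ 0 → y ≠ 0 → z ≠ 0 → φ x (y * z) = φ x y + φ x z)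
    (hst : ∀ x : K, x ≠ 0 → x ≠ 1 → φ x (1 - x) = 0)
    {x : K} (hx : x ≠ 0) : φ x (-x) = 0 := by
  rcases eq_or_ne x 1 with rfl | hx1
  · exact symbol_one_left hleft (neg_ne_zero.mpr one_ne_zero)
  have hinv : x⁻¹ ≠ 1 := by simpa using hx1
  have hsub : 1 - x⁻¹ ≠ 0 := sub_ne_zero.mpr hinv.symm
  have hzero : φ x (1 - x⁻¹) = 0 := by
    have h := hleft x x⁻¹ (1 - x⁻¹) hx (inv_ne_zero hx) hsub
    rw [mul_inv_cancel₀ hx, symbol_one_left hleft hsub, hst _ (inv_ne_zero hx) hinv,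
      add_zero] at h
    exact h.symm
  have h := hright x (-x) (1 - x⁻¹) hx (neg_ne_zero.mpr hx) hsub
  have hmul : -x * (1 - x⁻¹) = 1 - x := by field_simp; ring
  rw [hmul, hst x hx hx1, hzero, add_zero] at h
  exact h.symm

theorem steinberg_add_swap
    (hleft : ∀ x y z : K, x ≠ 0 → y ≠ 0 → z ≠ 0 → φ (x * y) z = φ x z + φ y z)
    (hright : ∀ x y z : K, x ≠ 0 → y ≠ 0 → z ≠ 0 → φ x (y * z) = φ x y + φ x z)
    (hst : ∀ x : K, x ≠ 0 → x ≠ 1 → φ x (1 - x) = 0)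
    {x y : K} (hx : x ≠ 0) (hy : y ≠ 0) : φ x y + φ y x = 0 := by
  have h := steinberg_self_neg hleft hright hst (mul_ne_zero hx hy)
  rw [hleft x y _ hx hy (neg_ne_zero.mpr (mul_ne_zero hx hy)), ← neg_mul,
    hright x (-x) y hx (neg_ne_zero.mpr hx) hy, neg_mul_comm,
    hright y x (-y) hy hx (neg_ne_zero.mpr hy), steinberg_self_neg hleft hright hst hx,
    steinberg_self_neg hleft hright hst hy, zero_add, add_zero] at h
  exact h

theorem steinberg_div_one_sub_div
    (hleft : ∀ x y z : K, x ≠ 0 → y ≠ 0 → z ≠ 0 → φ (x * y) z = φ x z + φ y z)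
    (hright : ∀ x y z : K, x ≠ 0 → y ≠ 0 → z ≠ 0 → φ x (y * z) = φ x y + φ x z)
    (hst : ∀ x : K, x ≠ 0 → x ≠ 1 → φ x (1 - x) = 0)
    {s u v : K} (hs : s ≠ 0) (hs1 : 1 - s ≠ 0) (hu : u ≠ 0) (hv : v ≠ 0)
    (huv : v - u * s = 1 - s) : φ (v / u) (1 - u / v * s) = φ v s := by
  have hw : 1 - u / v * s = (1 - s) / v := by rw [← huv]; field_simp
  have hw0 : 1 - u / v * s ≠ 0 := hw ▸ div_ne_zero hs1 hv
  have hus : u / v * s ≠ 0 := mul_ne_zero (div_ne_zero hu hv) hs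
  have hprod := hleft (v / u) (u / v * s) _ (div_ne_zero hv hu) hus hw0
  have hmul : v / u * (u / v * s) = s := by field_simp
  rw [hmul, hst _ hus (sub_ne_zero.mp hw0).symm, add_zero] at hprod
  have hsplit := hright s (1 - u / v * s) v hs hw0 hv
  have hwv : (1 - u / v * s) * v = 1 - s := by rw [hw, div_mul_cancel₀ _ hv]
  rw [hwv, hst s hs (sub_ne_zero.mp hs1).symm, hprod] at hsplit
  have hswap := steinberg_add_swap hleft hright hst hv hs
  exact (eq_neg_of_add_eq_zero_left hsplit.symm).trans (eq_neg_of_add_eq_zero_left hswap).symm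

end Symbol


/-- Lemma `lem:lcI`(2): for a Steinberg symbol `φ` on the fraction field `K` of a local
integral domain `R`, with `c : R`, `s t` in the maximal ideal, `s ≠ 0`, one has
`φ(1 + ((s−1)/(1+ct))ct, 1 − ((1+ct)/(1+cst))s) = φ(1+cst, s)`, i.e. the identity
`{1 + ((s−1)/(1+ct))ct, 1 − ((1+ct)/(1+cst))s} = {1+cst, s}` in `K₂^M(K)`. -/
theorem steinberg_identity_two
    (R : Type*) [CommRing R] [IsDomain R] [IsLocalRing R]
    (K : Type*) [Field K] [Algebra R K] [IsFractionRing R K]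
    (A : Type*) [AddCommGroup A]
    (φ : K → K → A)
    (hleft : ∀ x y z : K, x ≠ 0 → y ≠ 0 → z ≠ 0 → φ (x * y) z = φ x z + φ y z)
    (hright : ∀ x y z : K, x ≠ 0 → y ≠ 0 → z ≠ 0 → φ x (y * z) = φ x y + φ x z)
    (hst : ∀ x : K, x ≠ 0 → x ≠ 1 → φ x (1 - x) = 0)
    (c s t : R)
    (hs : s ∈ IsLocalRing.maximalIdeal R) (ht : t ∈ IsLocalRing.maximalIdeal R)
    (hs0 : s ≠ 0) :
    φ (1 + ((algebraMap R K s - 1) / (1 + algebraMap R K c * algebraMap R K t))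
          * algebraMap R K c * algebraMap R K t)
        (1 - ((1 + algebraMap R K c * algebraMap R K t) /
              (1 + algebraMap R K c * algebraMap R K s * algebraMap R K t))
          * algebraMap R K s)
      = φ (1 + algebraMap R K c * algebraMap R K s * algebraMap R K t)
          (algebraMap R K s) := by
  have hunit (r : R) (hr : r ∈ IsLocalRing.maximalIdeal R) : 1 - algebraMap R K r ≠ 0 := by
    have h := (IsLocalRing.isUnit_one_sub_self_of_mem_nonunits r hr).map (algebraMap R K)
    simpa using h.ne_zero
  have hu : 1 + algebraMap R K c * algebraMap R K t ≠ 0 := by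
    simpa using hunit (-c * t) (Ideal.mul_mem_left _ _ ht)
  have hv : 1 + algebraMap R K c * algebraMap R K s * algebraMap R K t ≠ 0 := by
    simpa using hunit (-(c * s) * t) (Ideal.mul_mem_left _ _ ht)
  have hs0' : algebraMap R K s ≠ 0 := by simpa using hs0
  have hfirst : 1 + ((algebraMap R K s - 1) / (1 + algebraMap R K c * algebraMap R K t))
        * algebraMap R K c * algebraMap R K t
      = (1 + algebraMap R K c * algebraMap R K s * algebraMap R K t)
        / (1 + algebraMap R K c * algebraMap R K t) := by
    field_simp
    ring
  rw [hfirst]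
  exact steinberg_div_one_sub_div hleft hright hst hs0' (hunit s hs) hu hv (by ring)
end

section
/- Let R be a regular local ring with maximal ideal 𝔪 and residue field k = R/𝔪, and let t₁, …, tₙ ∈ 𝔪 (with n ≥ 1) be part of a regular system of parameters, i.e. the images of t₁, …, tₙ in 𝔪/𝔪² are linearly independent over k. Set Rₙ := R/(tₙ) and let t̄ᵢ denote the image of tᵢ in Rₙ. Then the sequence 0 → 1 + tₙR → (R[1/(t₁⋯tₙ₋₁)])ˣ → (Rₙ[1/(t̄₁⋯t̄ₙ₋₁)])ˣ → 0 is exact. Precisely: every element of the set 1 + tₙR is a unit of R; the composite group homomorphism 1 + tₙR → Rˣ → (R[1/(t₁⋯tₙ₋₁)])ˣ is injective; its image equals the kernel of the homomorphism on unit groups induced by the canonical surjection R[1/(t₁⋯tₙ₋₁)] → Rₙ[1/(t̄₁⋯t̄ₙ₋₁)]; and this induced homomorphism on unit groups is surjective. (When n = 1 the empty product t₁⋯tₙ₋₁ is interpreted as 1, so the localizations are R and Rₙ themselves.) -/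
open IsLocalRing

section RegularLocalRing

variable {R : Type*} [CommRing R]

/-- In a Noetherian local ring, an element of `𝔪 \ 𝔪²` belongs to a generating set of `𝔪` of
minimal cardinality. -/
lemma IsLocalRing.exists_span_insert_eq_maximalIdeal [IsLocalRing R] [IsNoetherianRing R] {x : R}
    (hx : x ∈ maximalIdeal R) (hx2 : x ∉ maximalIdeal R ^ 2) :
    ∃ s : Set R, s.Finite ∧ s.ncard + 1 = (maximalIdeal R).spanFinrank ∧
      Ideal.span (insert x s) = maximalIdeal R := by
  set v : CotangentSpace R := (maximalIdeal R).toCotangent ⟨x, hx⟩ with hv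
  have hv0 : v ≠ 0 := by rwa [hv, Ne, Ideal.toCotangent_eq_zero]
  obtain ⟨b, -, hvb, hbspan, hbli⟩ := exists_linearIndepOn_id_extension
    (K := ResidueField R) (LinearIndepOn.singleton hv0)
    (Set.subset_univ _)
  have hvb : v ∈ b := hvb rfl
  have hbtop : Submodule.span (ResidueField R) b = ⊤ :=
    eq_top_iff.mpr fun y _ ↦ hbspan (Set.mem_univ y)
  have hbfin : b.Finite := hbli.finite
  obtain ⟨g, hg⟩ := (maximalIdeal R).toCotangent_surjective.hasRightInverse
  have hbcard : b.ncard = (maximalIdeal R).spanFinrank := by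
    have : Fintype b := hbfin.fintype
    rw [spanFinrank_maximalIdeal_eq_finrank_cotangentSpace, ← finrank_top, ← hbtop,
      finrank_span_set_eq_card hbli, Set.ncard_eq_toFinset_card']
  have hgen : Submodule.span R (insert ⟨x, hx⟩ (g '' (b \ {v}))) = ⊤ := by
    rw [← CotangentSpace.span_image_eq_top_iff, Set.image_insert_eq, ← Set.image_comp,
      hg.comp_eq_id, Set.image_id, ← hv, Set.insert_sdiff_singleton, Set.insert_eq_of_mem hvb, hbtop]
  refine ⟨(↑) '' (g '' (b \ {v})), ((hbfin.sdiff).image _).image _, ?_, ?_⟩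
  · rw [Set.ncard_image_of_injective _ Subtype.val_injective,
      Set.ncard_image_of_injective _ hg.injective, Set.ncard_sdiff_singleton_add_one hvb hbfin,
      hbcard]
  · have := congr_arg (Submodule.map (maximalIdeal R).subtype) hgen
    rwa [Submodule.map_span, Submodule.map_top, Submodule.range_subtype, Set.image_insert_eq]
      at this

lemma Ideal.quotient_span_singleton_isLocalRing [IsLocalRing R] {x : R}
    (hx : x ∈ maximalIdeal R) : IsLocalRing (R ⧸ Ideal.span {x}) := by
  have : Nontrivial (R ⧸ Ideal.span {x}) := Ideal.Quotient.nontrivial_iff.mpr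
    (ne_top_of_le_ne_top (maximalIdeal.isMaximal R).ne_top
      ((Ideal.span_singleton_le_iff_mem _).mpr hx))
  exact .of_surjective' _ Ideal.Quotient.mk_surjective

lemma IsLocalRing.map_mk_maximalIdeal [IsLocalRing R] (I : Ideal R) [IsLocalRing (R ⧸ I)] :
    (maximalIdeal R).map (Ideal.Quotient.mk I) = maximalIdeal (R ⧸ I) :=
  IsLocalRing.map_maximalIdeal_of_surjective _ Ideal.Quotient.mk_surjective

/-- The quotient of a regular local ring by an element of `𝔪 \ 𝔪²` is regular of embedding
dimension one less. -/
lemma IsRegularLocalRing.quotient_span_singleton [IsRegularLocalRing R] {x : R}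
    (hx : x ∈ maximalIdeal R) (hx2 : x ∉ maximalIdeal R ^ 2) :
    ∃ _ : IsRegularLocalRing (R ⧸ Ideal.span {x}),
      (maximalIdeal (R ⧸ Ideal.span {x})).spanFinrank + 1 = (maximalIdeal R).spanFinrank := by
  have := Ideal.quotient_span_singleton_isLocalRing hx
  obtain ⟨s, hs, hcard, hspan⟩ := exists_span_insert_eq_maximalIdeal hx hx2
  have hle : (maximalIdeal (R ⧸ Ideal.span {x})).spanFinrank ≤ s.ncard := by
    rw [← map_mk_maximalIdeal, ← hspan, Ideal.span_insert, Ideal.map_sup, Ideal.map_quotient_self,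
      bot_sup_eq, Ideal.map_span]
    exact (Submodule.spanFinrank_span_le_ncard_of_finite (hs.image _)).trans (Set.ncard_image_le hs)
  have hdim : ringKrullDim R ≤ ringKrullDim (R ⧸ Ideal.span {x}) + 1 := by
    rw [← maximalIdeal_height_eq_ringKrullDim]
    exact Ideal.height_le_ringKrullDim_quotient_add_one hx
  rw [← IsRegularLocalRing.spanFinrank_maximalIdeal, ← hcard, Nat.cast_add, Nat.cast_one,
    ENat.WithBot.add_le_add_one_right_iff] at hdim
  refine ⟨.of_spanFinrank_maximalIdeal_le _ ((Nat.cast_le.mpr hle).trans hdim), ?_⟩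
  have := hdim.trans (ringKrullDim_le_spanFinrank_maximalIdeal _)
  rw [← hcard, le_antisymm hle (Nat.cast_le.mp this)]

/-- A regular local ring that is not a field has an element of `𝔪 \ 𝔪²` outside all minimal
primes. -/
lemma IsRegularLocalRing.exists_mem_maximalIdeal_notMem_minimalPrimes [IsRegularLocalRing R]
    (h : (maximalIdeal R).spanFinrank ≠ 0) :
    ∃ x ∈ maximalIdeal R, x ∉ maximalIdeal R ^ 2 ∧ ∀ P ∈ minimalPrimes R, x ∉ P := by
  classical
  by_contra! hcon
  have hfin := minimalPrimes.finite_of_isNoetherianRing R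
  have hcover : (maximalIdeal R : Set R) ⊆
      ⋃ I ∈ (↑(insert (maximalIdeal R ^ 2) hfin.toFinset) : Set (Ideal R)), (id I : Ideal R) := by
    intro x hx
    by_cases hx2 : x ∈ maximalIdeal R ^ 2
    · exact Set.mem_biUnion (by simp) hx2
    · obtain ⟨P, hP, hxP⟩ := hcon x hx hx2
      exact Set.mem_biUnion (by simp [hP]) hxP
  rw [Ideal.subset_union_prime (maximalIdeal R ^ 2) (maximalIdeal R ^ 2)] at hcover
  · obtain ⟨I, hI, hle⟩ := hcover
    rcases Finset.mem_insert.mp hI with rfl | hI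
    · refine h ?_
      rw [Submodule.spanFinrank_eq_zero_iff_eq_bot (IsNoetherian.noetherian _)]
      refine Submodule.eq_bot_of_le_smul_of_le_jacobson_bot (maximalIdeal R) _
        (IsNoetherian.noetherian _) ?_ (jacobson_eq_maximalIdeal _ bot_ne_top).ge
      rwa [smul_eq_mul, ← pow_two]
    · have hI : I ∈ minimalPrimes R := hfin.mem_toFinset.mp hI
      have hIm : I = maximalIdeal R :=
        le_antisymm (le_maximalIdeal hI.1.1.ne_top) hle
      rw [hIm, ← Ideal.height_eq_zero_iff] at hI
      have := maximalIdeal_height_eq_ringKrullDim (R := R)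
      rw [hI, ← IsRegularLocalRing.spanFinrank_maximalIdeal] at this
      exact h (by exact_mod_cast this.symm)
  · intro I hI hne _
    exact (hfin.mem_toFinset.mp ((Finset.mem_insert.mp hI).resolve_left hne)).1.1

/-- A Noetherian local ring is a domain if some element of `𝔪` generates a prime ideal and avoids
all minimal primes. -/
lemma IsLocalRing.isDomain_of_isPrime_span_singleton [IsLocalRing R] [IsNoetherianRing R] {x : R}
    (hx : x ∈ maximalIdeal R) [hp : (Ideal.span {x}).IsPrime]
    (hmin : ∀ P ∈ minimalPrimes R, x ∉ P) : IsDomain R := by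
  obtain ⟨P, hP, hle⟩ := Ideal.exists_minimalPrimes_le (bot_le : ⊥ ≤ Ideal.span {x})
  have hPprime : P.IsPrime := hP.1.1
  suffices P = ⊥ by
    subst this
    exact IsDomain.of_bot_isPrime R
  refine Submodule.eq_bot_of_le_smul_of_le_jacobson_bot (maximalIdeal R) P
    (IsNoetherian.noetherian _) (fun y hy ↦ ?_) (jacobson_eq_maximalIdeal _ bot_ne_top).ge
  obtain ⟨z, rfl⟩ := Ideal.mem_span_singleton.mp (hle hy)
  exact Submodule.smul_mem_smul hx ((hPprime.mem_or_mem hy).resolve_left (hmin P hP))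

/-- A regular local ring is a domain. -/
theorem IsRegularLocalRing.isDomain (R : Type*) [CommRing R] [IsRegularLocalRing R] :
    IsDomain R := by
  induction hd : (maximalIdeal R).spanFinrank generalizing R with
  | zero =>
    rw [Submodule.spanFinrank_eq_zero_iff_eq_bot (IsNoetherian.noetherian _)] at hd
    exact (isField_iff_maximalIdeal_eq.mpr hd).isDomain
  | succ d ih =>
    obtain ⟨x, hx, hx2, hmin⟩ :=
      exists_mem_maximalIdeal_notMem_minimalPrimes (R := R) (by simp [hd])
    obtain ⟨_, hrank⟩ := quotient_span_singleton hx hx2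
    have := ih (R ⧸ Ideal.span {x}) (by omega)
    have := (Ideal.Quotient.isDomain_iff_prime (Ideal.span {x})).mp this
    exact isDomain_of_isPrime_span_singleton hx hmin

lemma IsRegularLocalRing.prime [IsRegularLocalRing R] {x : R} (hx : x ∈ maximalIdeal R)
    (hx2 : x ∉ maximalIdeal R ^ 2) : Prime x := by
  obtain ⟨_, -⟩ := quotient_span_singleton hx hx2
  have := IsRegularLocalRing.isDomain (R ⧸ Ideal.span {x})
  rw [← Ideal.span_singleton_prime (by rintro rfl; simp at hx2)]
  exact (Ideal.Quotient.isDomain_iff_prime _).mp this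

lemma IsLocalRing.notMem_sup_span_of_linearIndependent [IsLocalRing R] {ι : Type*} {t : ι → R}
    (htm : ∀ i, t i ∈ maximalIdeal R)
    (hli : LinearIndependent (ResidueField R)
      (fun i ↦ (maximalIdeal R).toCotangent ⟨t i, htm i⟩))
    {s : Set ι} {j : ι} (hj : j ∉ s) :
    t j ∉ maximalIdeal R ^ 2 ⊔ Ideal.span (t '' s) := by
  intro hmem
  let V := Submodule.span (ResidueField R)
    ((fun i ↦ ((maximalIdeal R).toCotangent ⟨t i, htm i⟩ : CotangentSpace R)) '' s)
  let N : Ideal R := ((V.restrictScalars R).comap (maximalIdeal R).toCotangent).map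
    (maximalIdeal R).subtype
  have hN : maximalIdeal R ^ 2 ⊔ Ideal.span (t '' s) ≤ N := by
    refine sup_le ?_ (Ideal.span_le.mpr ?_)
    · rw [← Ideal.map_toCotangent_ker]
      exact Submodule.map_mono (Submodule.comap_mono bot_le)
    · rintro _ ⟨i, hi, rfl⟩
      exact ⟨⟨t i, htm i⟩, Submodule.subset_span ⟨i, hi, rfl⟩, rfl⟩
  obtain ⟨y, hy, hyj⟩ := hN hmem
  obtain rfl : y = ⟨t j, htm j⟩ := Subtype.ext hyj
  exact hli.notMem_span_image hj hy

end RegularLocalRing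

section PrimeProducts

variable {ι A : Type*} [Fintype ι] [CommRing A] [IsDomain A] {p : ι → A}

/-- A divisor of a power of a product of primes is a unit times a product of powers of them. -/
lemma exists_unit_mul_prod_pow_of_mul_eq (hp : ∀ i, Prime (p i)) {N : ℕ} {a b : A}
    (h : a * b = (∏ i, p i) ^ N) : ∃ (u : Aˣ) (e : ι → ℕ), a = u * ∏ i, p i ^ e i := by
  classical
  induction N generalizing a b with
  | zero => exact ⟨.mkOfMulEqOne a b (by simpa using h), 0, by simp⟩
  | succ N ih =>
    obtain ⟨s, -, c, d, -, -, hcd, rfl, -⟩ := mul_eq_mul_prime_prod (fun i _ ↦ hp i) ((pow_succ (∏ i, p i) N) ▸ h)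
    obtain ⟨u, e, rfl⟩ := ih hcd.symm
    refine ⟨u, fun i ↦ e i + if i ∈ s then 1 else 0, ?_⟩
    simp only [pow_add, Finset.prod_mul_distrib, pow_ite, pow_one, pow_zero, Finset.prod_ite_mem,
      Finset.univ_inter, mul_assoc]

lemma emultiplicity_unit_mul_prod_pow (hp : ∀ i, Prime (p i))
    (hndvd : ∀ i j, i ≠ j → ¬ p i ∣ p j) (u : Aˣ) (e : ι → ℕ) (i : ι) :
    emultiplicity (p i) (u * ∏ j, p j ^ e j) = e i := by
  classical
  rw [emultiplicity_mul (hp i), Finset.emultiplicity_prod (hp i), Finset.sum_eq_single i,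
    emultiplicity_pow_self (hp i).ne_zero (hp i).not_isUnit, emultiplicity_eq_zero.mpr, zero_add]
  · exact fun h ↦ (hp i).not_isUnit (isUnit_of_dvd_unit h u.isUnit)
  · exact fun j _ hj ↦ emultiplicity_eq_zero.mpr fun h ↦
      hndvd i j hj.symm ((hp i).dvd_of_dvd_pow h)
  · simp

/-- A unit of the localization of a domain away from a product of primes is, up to a power of that
product, a unit times a product of powers of these primes. -/
lemma IsLocalization.Away.exists_unit_mul_prod_pow {S : Type*} [CommRing S] [Algebra A S]
    (hp : ∀ i, Prime (p i)) [IsLocalization.Away (∏ i, p i) S] (x : Sˣ) :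
    ∃ (N : ℕ) (u : Aˣ) (e : ι → ℕ),
      (x : S) * algebraMap A S ((∏ i, p i) ^ N) = algebraMap A S (u * ∏ i, p i ^ e i) := by
  obtain ⟨N, a, ha⟩ := IsLocalization.Away.surj (∏ i, p i) (x : S)
  obtain ⟨M, b, hb⟩ := IsLocalization.Away.surj (∏ i, p i) ((x⁻¹ : Sˣ) : S)
  have hinj : Function.Injective (algebraMap A S) := IsLocalization.injective (M := .powers (∏ i, p i)) S
    (powers_le_nonZeroDivisors_of_noZeroDivisors
      (Finset.prod_ne_zero_iff.mpr fun i _ ↦ (hp i).ne_zero))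
  have hab : a * b = (∏ i, p i) ^ (N + M) := hinj <| by
    rw [map_mul, ← ha, ← hb, mul_mul_mul_comm, Units.mul_inv, one_mul, map_pow, pow_add]
  obtain ⟨u, e, rfl⟩ := exists_unit_mul_prod_pow_of_mul_eq hp hab
  exact ⟨N, u, e, by rw [map_pow, ha]⟩

/-- Let `q : A → B` be a surjection of domains with `A` local, and let `pᵢ` be primes of `A` whose
images are pairwise non-dividing primes of `B`. Then `A[1/∏ pᵢ]ˣ → B[1/∏ q(pᵢ)]ˣ` is surjective
with kernel `1 + ker q`. -/
lemma IsLocalization.Away.units_map_exact [IsLocalRing A] {B S T : Type*} [CommRing B] [IsDomain B]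
    [CommRing S] [Algebra A S] [CommRing T] [Algebra B T] {q : A →+* B}
    (hq : Function.Surjective q) (hp : ∀ i, Prime (p i)) (hqp : ∀ i, Prime (q (p i)))
    (hndvd : ∀ i j, i ≠ j → ¬ q (p i) ∣ q (p j))
    [IsLocalization.Away (∏ i, p i) S] [IsLocalization.Away (∏ i, q (p i)) T]
    (ψ : S →+* T) (hψ : ∀ a, ψ (algebraMap A S a) = algebraMap B T (q a)) :
    (∀ x : Sˣ, Units.map ψ.toMonoidHom x = 1 ↔
      ∃ a ∈ RingHom.ker q, (x : S) = algebraMap A S (1 + a)) ∧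
    Function.Surjective (Units.map ψ.toMonoidHom) := by
  have hqP : q (∏ i, p i) = ∏ i, q (p i) := map_prod ..
  have hqP0 : ∏ i, q (p i) ≠ 0 := Finset.prod_ne_zero_iff.mpr fun i _ ↦ (hqp i).ne_zero
  have hqinj : Function.Injective (algebraMap B T) :=
    IsLocalization.injective (M := .powers (∏ i, q (p i))) T
      (powers_le_nonZeroDivisors_of_noZeroDivisors hqP0)
  have hPunit (N : ℕ) : IsUnit (algebraMap A S ((∏ i, p i) ^ N)) := by
    rw [map_pow]
    exact (IsLocalization.Away.algebraMap_isUnit (∏ i, p i)).pow N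
  refine ⟨fun x ↦ ⟨fun hx ↦ ?_, ?_⟩, fun y ↦ ?_⟩
  · have hx1 : ψ x = 1 := congr_arg Units.val hx
    obtain ⟨N, u, e, hu⟩ := IsLocalization.Away.exists_unit_mul_prod_pow hp x
    have hqu : (∏ i, q (p i)) ^ N = q u * ∏ i, q (p i) ^ e i := hqinj <| by
      have := congr_arg ψ hu
      rwa [map_mul, hx1, one_mul, hψ, hψ, map_mul q, map_pow q, hqP, map_prod q,
        Finset.prod_congr rfl fun i _ ↦ map_pow q (p i) (e i)] at this
    have he (i : ι) : e i = N := by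
      have h1 := emultiplicity_unit_mul_prod_pow hqp hndvd (u.map q.toMonoidHom) e i
      have h2 := emultiplicity_unit_mul_prod_pow hqp hndvd 1 (fun _ ↦ N) i
      rw [Finset.prod_pow, Units.val_one, one_mul, hqu] at h2
      exact_mod_cast h1.symm.trans h2
    simp only [he, Finset.prod_pow] at hu hqu
    rw [map_mul, (hPunit N).mul_left_inj] at hu
    refine ⟨u - 1, ?_, by rw [hu, add_sub_cancel]⟩
    rw [RingHom.mem_ker, map_sub, map_one, sub_eq_zero]
    exact mul_right_cancel₀ (pow_ne_zero N hqP0) (hqu.symm.trans (one_mul _).symm)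
  · rintro ⟨a, ha, hx⟩
    ext
    simp [hx, hψ, (RingHom.mem_ker).mp ha]
  · obtain ⟨N, u, e, hu⟩ := IsLocalization.Away.exists_unit_mul_prod_pow hqp y
    obtain ⟨v, hv⟩ := hq u
    have : IsLocalHom q := .of_surjective q hq
    have hvunit : IsUnit v := isUnit_of_map_unit q v (hv ▸ u.isUnit)
    have hunit : IsUnit (algebraMap A S (v * ∏ i, p i ^ e i)) := by
      rw [map_mul, map_prod]
      refine (hvunit.map _).mul (IsUnit.prod_univ_iff.mpr fun i ↦ ?_)
      rw [map_pow]
      exact (IsLocalization.Away.isUnit_of_dvd (∏ i, p i)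
        (Finset.dvd_prod_of_mem _ (Finset.mem_univ i))).pow _
    refine ⟨hunit.unit * (hPunit N).unit⁻¹, ?_⟩
    rw [map_mul, map_inv, mul_inv_eq_iff_eq_mul]
    ext
    change ψ (algebraMap A S _) = y * ψ (algebraMap A S _)
    rw [hψ, hψ, map_pow, hqP, hu, map_mul, map_prod, hv]
    simp only [map_pow]

end PrimeProducts

/-- Lemma `lem:Ker-reg`: let `R` be a regular local ring (Noetherian local with Krull
dimension equal to `dim_k 𝔪/𝔪²`) and `t₀, …, tₙ ∈ 𝔪` (with `n + 1 ≥ 1` elements) part of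
a regular system of parameters, i.e. their images in `𝔪/𝔪²` are linearly independent over
the residue field.  Let `S = R[1/(t₀⋯tₙ₋₁)]` (localization away from the product of all
but the last parameter), `Rₙ = R/(tₙ)`, `Sₙ = Rₙ[1/(t̄₀⋯t̄ₙ₋₁)]`, and let
`ψ : S →+* Sₙ` be the induced ring homomorphism (characterized by compatibility with the
quotient map on `R`).  Then the sequence
`0 → 1 + tₙR → Sˣ → Sₙˣ → 0` is exact: every element of `1 + tₙR` is a unit of `R`;
the composite `1 + tₙR → Rˣ → Sˣ` is injective; its image is exactly the kernel of
`Units.map ψ`; and `Units.map ψ` is surjective. -/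
theorem units_sequence_of_regular_parameters_exact
    (R : Type*) [CommRing R] [IsNoetherianRing R] [IsLocalRing R]
    (hreg : ringKrullDim R
      = (Module.finrank (ResidueField R) (CotangentSpace R) : WithBot (WithTop ℕ)))
    (n : ℕ) (t : Fin (n + 1) → R)
    (htm : ∀ i, t i ∈ maximalIdeal R)
    (hli : LinearIndependent (ResidueField R)
      (fun i : Fin (n + 1) => (maximalIdeal R).toCotangent ⟨t i, htm i⟩))
    (ψ : Localization.Away (∏ i : Fin n, t i.castSucc) →+*
      Localization.Away
        ((Ideal.Quotient.mk (Ideal.span {t (Fin.last n)})) (∏ i : Fin n, t i.castSucc)))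
    (hψ : ∀ r : R,
      ψ (algebraMap R (Localization.Away (∏ i : Fin n, t i.castSucc)) r)
        = algebraMap (R ⧸ Ideal.span {t (Fin.last n)})
            (Localization.Away
              ((Ideal.Quotient.mk (Ideal.span {t (Fin.last n)}))
                (∏ i : Fin n, t i.castSucc)))
            ((Ideal.Quotient.mk (Ideal.span {t (Fin.last n)})) r)) :
    (∀ a : R, IsUnit (1 + t (Fin.last n) * a)) ∧
    (∀ a b : R,
      algebraMap R (Localization.Away (∏ i : Fin n, t i.castSucc))
          (1 + t (Fin.last n) * a)
        = algebraMap R (Localization.Away (∏ i : Fin n, t i.castSucc))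
            (1 + t (Fin.last n) * b)
      → (1 : R) + t (Fin.last n) * a = 1 + t (Fin.last n) * b) ∧
    (∀ x : (Localization.Away (∏ i : Fin n, t i.castSucc))ˣ,
      Units.map ψ.toMonoidHom x = 1 ↔
        ∃ a : R, (x : Localization.Away (∏ i : Fin n, t i.castSucc))
          = algebraMap R (Localization.Away (∏ i : Fin n, t i.castSucc))
              (1 + t (Fin.last n) * a)) ∧
    Function.Surjective (Units.map ψ.toMonoidHom) := by
  have hR : IsRegularLocalRing R := (IsRegularLocalRing.iff_finrank_cotangentSpace R).mpr hreg.symm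
  have hxm : t (Fin.last n) ∈ maximalIdeal R := htm _
  have hnot {s : Set (Fin (n + 1))} {j : Fin (n + 1)} (hj : j ∉ s) :=
    notMem_sup_span_of_linearIndependent htm hli hj
  have hnot2 (j : Fin (n + 1)) : t j ∉ maximalIdeal R ^ 2 := fun h ↦
    hnot (Set.notMem_empty j) (Ideal.mem_sup_left h)
  obtain ⟨_, -⟩ := IsRegularLocalRing.quotient_span_singleton hxm (hnot2 _)
  have := IsRegularLocalRing.isDomain R
  have := IsRegularLocalRing.isDomain (R ⧸ Ideal.span {t (Fin.last n)})
  let q := Ideal.Quotient.mk (Ideal.span {t (Fin.last n)})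
  have hq : Function.Surjective q := Ideal.Quotient.mk_surjective
  have hprime (i : Fin n) : Prime (t i.castSucc) := IsRegularLocalRing.prime (htm _) (hnot2 _)
  have hqprime (i : Fin n) : Prime (q (t i.castSucc)) := by
    refine IsRegularLocalRing.prime ?_ fun h ↦ ?_
    · rw [← map_mk_maximalIdeal]
      exact Ideal.mem_map_of_mem _ (htm _)
    · rw [← map_mk_maximalIdeal, ← Ideal.map_pow, Ideal.mem_quotient_iff_mem_sup] at h
      refine hnot (s := {Fin.last n}) (j := i.castSucc) ?_ (by rwa [Set.image_singleton])
      simp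
  have hndvd (i j : Fin n) (hij : i ≠ j) : ¬ q (t i.castSucc) ∣ q (t j.castSucc) := by
    rw [← Ideal.mem_span_singleton, ← Set.image_singleton (f := q), ← Ideal.map_span,
      Ideal.mem_quotient_iff_mem_sup, ← Ideal.span_union, Set.singleton_union]
    intro h
    refine hnot (s := {i.castSucc, Fin.last n}) (j := j.castSucc) ?_ (Ideal.mem_sup_right ?_)
    · simp [hij.symm]
    · rwa [Set.image_pair]
  have hP : q (∏ i : Fin n, t i.castSucc) = ∏ i : Fin n, q (t i.castSucc) := map_prod ..
  have : IsLocalization.Away (∏ i : Fin n, q (t i.castSucc))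
      (Localization.Away (q (∏ i : Fin n, t i.castSucc))) := hP ▸ inferInstance
  obtain ⟨hker, hsurj⟩ := IsLocalization.Away.units_map_exact hq hprime hqprime hndvd ψ hψ
  refine ⟨fun a ↦ ?_, fun a b h ↦ ?_, fun y ↦ ?_, hsurj⟩
  · rw [← IsLocalRing.notMem_maximalIdeal]
    exact fun h ↦ (maximalIdeal.isMaximal R).ne_top <| (Ideal.eq_top_iff_one _).mpr <|
      (Ideal.add_mem_iff_left _ (Ideal.mul_mem_right a _ hxm)).mp h
  · exact IsLocalization.injective (M := .powers (∏ i : Fin n, t i.castSucc)) _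
      (powers_le_nonZeroDivisors_of_noZeroDivisors
        (Finset.prod_ne_zero_iff.mpr fun i _ ↦ (hprime i).ne_zero)) h
  · rw [hker, Ideal.mk_ker]
    simp only [Ideal.mem_span_singleton', mul_comm _ (t (Fin.last n)), exists_exists_eq_and]
end

section
/- Let R be a commutative local ring with maximal ideal 𝔪 and let t ∈ 𝔪. Then the set 1 + tR = {1 + t·a : a ∈ R} is a subgroup of the group of units Rˣ, and it is multiplicatively generated by the elements of the form 1 + t·u with u ∈ Rˣ; in fact, every element of 1 + tR is a product of at most two elements of the form 1 + t·u with u ∈ Rˣ. (Explicitly, if a ∈ 𝔪 then 1 + t·a = (1 + t·u)·(1 + t·v) with u = a − 1 ∈ Rˣ and v = (1 + t·u)⁻¹ ∈ Rˣ.) -/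
/-- For a commutative local ring `R` with maximal ideal `𝔪` and `t ∈ 𝔪`, the set
`1 + tR` consists of units, is closed under multiplication and inverses (hence is a
subgroup of `Rˣ`), and every element of `1 + tR` is a product of at most two elements
of the form `1 + t·u` with `u ∈ Rˣ`. -/
theorem one_add_t_mul_subgroup_generated_by_units
    (R : Type*) [CommRing R] [IsLocalRing R]
    (t : R) (htm : t ∈ IsLocalRing.maximalIdeal R) :
    (∀ a : R, IsUnit (1 + t * a)) ∧
    (∀ a b : R, ∃ c : R, (1 + t * a) * (1 + t * b) = 1 + t * c) ∧
    (∀ a : R, ∃ b : R, (1 + t * a) * (1 + t * b) = 1) ∧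
    (∀ a : R, (∃ u : Rˣ, 1 + t * a = 1 + t * (u : R)) ∨
      (∃ u v : Rˣ, 1 + t * a = (1 + t * (u : R)) * (1 + t * (v : R)))) := by
  have isUnit_one_add {x : R} (hx : x ∈ IsLocalRing.maximalIdeal R) : IsUnit (1 + x) := by
    by_contra h
    have h1 := (IsLocalRing.maximalIdeal R).sub_mem ((IsLocalRing.mem_maximalIdeal _).2 h) hx
    rw [add_sub_cancel_right] at h1
    exact (IsLocalRing.mem_maximalIdeal _).1 h1 isUnit_one
  have hunit (a : R) : IsUnit (1 + t * a) :=
    isUnit_one_add (Ideal.mul_mem_right a _ htm)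
  refine ⟨hunit, fun a b ↦ ⟨a + b + t * a * b, by ring⟩, fun a ↦ ?_, fun a ↦ ?_⟩
  · obtain ⟨x, hx⟩ := (hunit a).exists_right_inv
    exact ⟨-(a * x), by linear_combination (-t * a) * hx⟩
  · by_cases ha : IsUnit a
    · exact Or.inl ⟨ha.unit, rfl⟩
    · obtain ⟨u, hu⟩ : IsUnit (a - 1) := by
        have h := isUnit_one_add (neg_mem ((IsLocalRing.mem_maximalIdeal a).2 ha))
        simpa [sub_eq_add_neg, add_comm] using h.neg
      obtain ⟨w, hw⟩ := hunit u
      refine Or.inr ⟨u, w⁻¹, ?_⟩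
      have hwv : (1 + t * (u : R)) * ((w⁻¹ : Rˣ) : R) = 1 := by rw [← hw, Units.mul_inv]
      linear_combination (-t) * hu - t * hwv
end
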